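/- Let M = ⊕_{j=1}^{s} 𝔖/(p, u^{r_j}) with integers r_j ≥ 0. Then for every n ≥ 0: (1) length(M^{(n)}[E]) = Σ_j min(e, p^n r_j), where the length is taken over 𝔖/E; (2) length(M^{(n+1)}[E]) ≥ length(M^{(n)}[E]); and (3) e · length(M^{(1)}[E]) ≥ length(M^{(m)}[E]) for every m ≥ 0 (provided M ≠ 0, all r_j ≥ 1). -/

import Mathlib

/-- The length of a module, defined as the Krull dimension of its lattice of submodules. -/
noncomputable def moduleLength (R M : Type*) [Ring R] [AddCommGroup M] [Module R M] :
    WithBot ℕ∞ :=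
  Order.krullDim (Submodule R M)

/-- The `n`-th Frobenius twist of `M = ⊕_{j} 𝔖/(p, u^{r_j})`, which (via
`𝔖 ⊗_{𝔖,φ^n} 𝔖/(p,u^r) ≅ 𝔖/(p, u^{pⁿr})`) is `⊕_j 𝔖/(p, u^{pⁿ r_j})`. -/
abbrev twModel (p : ℕ) [Fact p.Prime] (k : Type*) [Field k] [CharP k p]
    (s : ℕ) (r : Fin s → ℕ) (n : ℕ) : Type _ :=
  ∀ j : Fin s, PowerSeries (WittVector p k) ⧸
    Ideal.span {(p : PowerSeries (WittVector p k)),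
      (PowerSeries.X : PowerSeries (WittVector p k)) ^ (p ^ n * r j)}

open Submodule in
/-- The `a`-torsion of a product is the product of the `a`-torsion submodules. -/
def torsionByPiEquiv {A : Type*} [CommRing A] {ι : Type*} (N : ι → Type*)
    [∀ i, AddCommGroup (N i)] [∀ i, Module A (N i)] (a : A) :
    torsionBy A (∀ i, N i) a ≃ₗ[A] ∀ i, torsionBy A (N i) a where
  toFun x i := ⟨x.1 i, (mem_torsionBy_iff a _).2
    (congrFun ((mem_torsionBy_iff a _).1 x.2) i)⟩
  invFun y := ⟨fun i ↦ (y i).1, (mem_torsionBy_iff a _).2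
    (funext fun i ↦ (mem_torsionBy_iff a _).1 (y i).2)⟩
  map_add' _ _ := rfl
  map_smul' _ _ := rfl
  left_inv _ := rfl
  right_inv _ := rfl

/-- Lengths of cyclic modules may be computed after a surjective change of rings. -/
theorem Ideal.length_quotient_comap {A B : Type*} [CommRing A] [CommRing B] (f : A →+* B)
    (hf : Function.Surjective f) (J : Ideal B) :
    Module.length A (A ⧸ J.comap f) = Module.length B (B ⧸ J) := by
  algebraize [f]
  rw [← Module.length_eq_of_surjective (S := A) (R := B) (M := B ⧸ J) hf]
  let g : A →ₗ[A] B ⧸ J := (J.mkQ.restrictScalars A).comp (Algebra.linearMap A B)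
  have hg : Function.Surjective g := (Submodule.mkQ_surjective J).comp hf
  have hker : LinearMap.ker g = J.comap f := by
    ext x
    exact Submodule.Quotient.mk_eq_zero J
  exact ((Submodule.quotEquivOfEq _ _ hker.symm).trans
    (g.quotKerEquivOfSurjective hg)).length_eq

/-- If `A ⧸ I` has finite length, its `a`-torsion has the same length as its quotient by `a`. -/
theorem Ideal.length_torsionBy_quotient {A : Type*} [CommRing A] (I : Ideal A) (a : A)
    (hI : Module.length A (A ⧸ I) ≠ ⊤) :
    Module.length A (Submodule.torsionBy A (A ⧸ I) a) =
      Module.length A (A ⧸ (I ⊔ Ideal.span {a})) := by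
  let g : (A ⧸ I) →ₗ[A] A ⧸ I := LinearMap.lsmul A (A ⧸ I) a
  let q : (A ⧸ I) →ₗ[A] A ⧸ (I ⊔ Ideal.span {a}) := Submodule.factor le_sup_left
  have hq : Function.Surjective q := Submodule.factor_surjective _
  have h₁ := Module.length_eq_add_of_exact (LinearMap.ker g).subtype g.rangeRestrict
    (Submodule.subtype_injective _) g.surjective_rangeRestrict (fun x ↦ by
      rw [← LinearMap.mem_ker, LinearMap.ker_rangeRestrict]; simp)
  have h₂ := Module.length_eq_add_of_exact (LinearMap.range g).subtype q
    (Submodule.subtype_injective _) hq (fun x ↦ by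
      obtain ⟨x, rfl⟩ := Submodule.mkQ_surjective I x
      have : q (I.mkQ x) = 0 ↔ x ∈ I ⊔ Ideal.span {a} := Submodule.Quotient.mk_eq_zero _
      rw [this]
      simp only [Submodule.coe_subtype, Subtype.range_coe_subtype, LinearMap.mem_range,
        Set.mem_ofPred_eq]
      constructor
      · intro hx
        obtain ⟨y, hy, z, hz, rfl⟩ := Submodule.mem_sup.1 hx
        obtain ⟨c, rfl⟩ := Ideal.mem_span_singleton'.1 hz
        refine ⟨I.mkQ c, ?_⟩
        change I.mkQ (a * c) = _
        rw [map_add, (Submodule.Quotient.mk_eq_zero I).2 hy |> fun h ↦ (h : I.mkQ y = 0),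
          zero_add, mul_comm]
      · rintro ⟨y, hy⟩
        obtain ⟨y, rfl⟩ := Submodule.mkQ_surjective I y
        have h : x - a * y ∈ I := (Submodule.Quotient.eq I).1 hy.symm
        rw [← sub_add_cancel x (a * y)]
        exact Submodule.add_mem_sup h (Ideal.mul_mem_right _ _ (Ideal.mem_span_singleton_self a)))
  have hr : Module.length A (LinearMap.range g) ≠ ⊤ := fun h ↦ hI (by rw [h₂, h, top_add])
  rw [h₂, add_comm] at h₁
  exact ((ENat.add_left_injective_of_ne_top hr) h₁).symm

namespace PowerSeries

theorem length_quotient_span_X_pow (k : Type*) [Field k] (r : ℕ) :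
    Module.length (PowerSeries k) (PowerSeries k ⧸ Ideal.span {(X : PowerSeries k) ^ r}) = r := by
  have hX : (Ideal.span {(X : PowerSeries k)}).IsMaximal := by
    rw [← maximalIdeal_eq_span_X]; infer_instance
  have h₁ : Ring.ord (PowerSeries k) X = 1 :=
    Module.length_eq_one_iff.2 (isSimpleModule_iff_isCoatom.2 hX.out)
  have := Ring.ord_pow (mem_nonZeroDivisors_of_ne_zero (X_ne_zero (R := k))) r
  rw [h₁] at this
  simpa [Ring.ord] using this

variable {p : ℕ} [Fact p.Prime] {k : Type*} [Field k]

theorem map_wittVector_constantCoeff_surjective :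
    Function.Surjective (map (WittVector.constantCoeff : WittVector p k →+* k)) :=
  map_surjective _ fun x ↦ ⟨WittVector.teichmuller p x, WittVector.teichmuller_coeff_zero p x⟩

theorem span_p_X_pow_sup_span {F : PowerSeries (WittVector p k)} {e : ℕ}
    (hF : (p : PowerSeries (WittVector p k)) ∣ F - X ^ e) (r : ℕ) :
    Ideal.span {(p : PowerSeries (WittVector p k)), (X : PowerSeries (WittVector p k)) ^ r} ⊔
      Ideal.span {F} =
    Ideal.span {(p : PowerSeries (WittVector p k)),
      (X : PowerSeries (WittVector p k)) ^ min e r} := by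
  obtain ⟨g, hg⟩ := hF
  apply le_antisymm
  · refine sup_le (Ideal.span_le.2 ?_) (Ideal.span_le.2 ?_)
    · rintro x (rfl | rfl)
      · exact Ideal.subset_span (by simp)
      · exact Ideal.mem_of_dvd _ (pow_dvd_pow X (min_le_right e r)) (Ideal.subset_span (by simp))
    · rintro x rfl
      obtain ⟨c, hc⟩ := pow_dvd_pow (X : PowerSeries (WittVector p k)) (min_le_left e r)
      exact Ideal.mem_span_pair.2 ⟨g, c, by linear_combination -hg - hc⟩
  · rw [Ideal.span_le]
    rintro x (rfl | rfl)
    · exact Ideal.mem_sup_left (Ideal.subset_span (by simp))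
    · rcases min_choice e r with h | h <;> rw [h]
      · have h₁ : (p : PowerSeries (WittVector p k)) * g ∈
            Ideal.span {(p : PowerSeries (WittVector p k)), X ^ r} :=
          Ideal.mul_mem_right _ _ (Ideal.subset_span (by simp))
        have := sub_mem (Ideal.mem_sup_right (Ideal.mem_span_singleton_self F))
          (Ideal.mem_sup_left (T := Ideal.span {F}) h₁)
        rwa [← hg, sub_sub_cancel] at this
      · exact Ideal.mem_sup_left (Ideal.subset_span (by simp))

variable [CharP k p] [PerfectRing k p]

theorem map_wittVector_constantCoeff_eq_zero_iff (f : PowerSeries (WittVector p k)) :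
    map (WittVector.constantCoeff : WittVector p k →+* k) f = 0 ↔
      (p : PowerSeries (WittVector p k)) ∣ f := by
  constructor
  · intro h
    have hc (n : ℕ) : (p : WittVector p k) ∣ coeff n f := by
      rw [← Ideal.mem_span_singleton, WittVector.mem_span_p_iff_coeff_zero_eq_zero]
      simpa using congrArg (coeff n) h
    choose g hg using hc
    refine ⟨mk g, ext fun n ↦ ?_⟩
    rw [← map_natCast (C (R := WittVector p k)), coeff_C_mul, coeff_mk, hg]
  · rintro ⟨g, rfl⟩
    rw [_root_.map_mul, map_natCast, ← map_natCast (C (R := k)), CharP.cast_eq_zero, map_zero,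
      zero_mul]

theorem span_p_X_pow_eq_comap (r : ℕ) :
    Ideal.span {(p : PowerSeries (WittVector p k)), (X : PowerSeries (WittVector p k)) ^ r} =
      (Ideal.span {(X : PowerSeries k) ^ r}).comap (map WittVector.constantCoeff) := by
  apply le_antisymm
  · rw [Ideal.span_le]
    rintro x (rfl | rfl)
    · rw [SetLike.mem_coe, Ideal.mem_comap,
        (map_wittVector_constantCoeff_eq_zero_iff _).2 dvd_rfl]
      exact zero_mem _
    · rw [SetLike.mem_coe, Ideal.mem_comap, map_pow, map_X]
      exact Ideal.mem_span_singleton_self _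
  · intro f hf
    obtain ⟨g, hg⟩ := Ideal.mem_span_singleton.1 (Ideal.mem_comap.1 hf)
    obtain ⟨g, rfl⟩ := map_wittVector_constantCoeff_surjective (p := p) g
    obtain ⟨h, hh⟩ := (map_wittVector_constantCoeff_eq_zero_iff (f - X ^ r * g)).1 (by
      rw [map_sub, _root_.map_mul, map_pow, map_X, hg, sub_self])
    exact Ideal.mem_span_pair.2 ⟨h, g, by linear_combination -hh⟩

theorem length_quotient_span_p_X_pow (r : ℕ) :
    Module.length (PowerSeries (WittVector p k)) (PowerSeries (WittVector p k) ⧸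
      Ideal.span {(p : PowerSeries (WittVector p k)),
        (X : PowerSeries (WittVector p k)) ^ r}) = r := by
  rw [span_p_X_pow_eq_comap, Ideal.length_quotient_comap _ map_wittVector_constantCoeff_surjective,
    length_quotient_span_X_pow]

theorem length_torsionBy_quotient_span_p_X_pow {F : PowerSeries (WittVector p k)} {e : ℕ}
    (hF : (p : PowerSeries (WittVector p k)) ∣ F - X ^ e) (r : ℕ) :
    Module.length (PowerSeries (WittVector p k)) (Submodule.torsionBy (PowerSeries (WittVector p k))
      (PowerSeries (WittVector p k) ⧸ Ideal.span {(p : PowerSeries (WittVector p k)),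
        (X : PowerSeries (WittVector p k)) ^ r}) F) = (min e r : ℕ) := by
  rw [Ideal.length_torsionBy_quotient _ F
      (by rw [length_quotient_span_p_X_pow]; exact ENat.natCast_ne_top _),
    span_p_X_pow_sup_span hF, length_quotient_span_p_X_pow]

end PowerSeries

theorem Polynomial.p_dvd_coe_sub_X_pow {R : Type*} [CommRing R] {E : Polynomial R} {a : ℕ}
    (hE : E.Monic) (hco : ∀ i < E.natDegree, (a : R) ∣ E.coeff i) :
    (a : PowerSeries R) ∣ (E : PowerSeries R) - PowerSeries.X ^ E.natDegree := by
  have h : Polynomial.C (a : R) ∣ E - Polynomial.X ^ E.natDegree := by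
    rw [Polynomial.C_dvd_iff_dvd_coeff]
    intro i
    rw [Polynomial.coeff_sub, Polynomial.coeff_X_pow]
    rcases lt_trichotomy i E.natDegree with h | rfl | h
    · simpa [h.ne] using hco i h
    · simp [hE.coeff_natDegree]
    · simp [h.ne', Polynomial.coeff_eq_zero_of_natDegree_lt h]
  simpa [Polynomial.coe_sub] using _root_.map_dvd (Polynomial.coeToPowerSeries.ringHom (R := R)) h

theorem moduleLength_torsionBy_twModel {p : ℕ} [Fact p.Prime] {k : Type*} [Field k] [CharP k p]
    [PerfectRing k p] {F : PowerSeries (WittVector p k)} {e : ℕ}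
    (hF : (p : PowerSeries (WittVector p k)) ∣ F - PowerSeries.X ^ e)
    (s : ℕ) (r : Fin s → ℕ) (n : ℕ) :
    moduleLength (PowerSeries (WittVector p k))
      (Submodule.torsionBy (PowerSeries (WittVector p k)) (twModel p k s r n) F) =
      ((∑ j, min e (p ^ n * r j) : ℕ) : WithBot ℕ∞) := by
  refine (Module.coe_length (PowerSeries (WittVector p k))
    (Submodule.torsionBy (PowerSeries (WittVector p k)) (twModel p k s r n) F)).symm.trans ?_
  rw [(torsionByPiEquiv _ F).length_eq, Module.length_pi_of_fintype]
  refine (congrArg _ (Finset.sum_congr rfl fun j _ ↦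
    PowerSeries.length_torsionBy_quotient_span_p_X_pow hF (p ^ n * r j))).trans ?_
  norm_cast

/-- Let `k` be a perfect field of characteristic `p`, `W = W(k)`,
`𝔖 = W[[u]]` with its Frobenius lift, `E ∈ W[u]` Eisenstein of degree `e ≥ 1`, and
`M = ⊕_{j=1}^{s} 𝔖/(p, u^{r_j})`. Then for every `n ≥ 0` (with
`M^{(n)} = ⊕_j 𝔖/(p, u^{pⁿ r_j})` its Frobenius twist):
(1) `length(M^{(n)}[E]) = Σ_j min(e, pⁿ r_j)`;
(2) `length(M^{(n+1)}[E]) ≥ length(M^{(n)}[E])`;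
(3) `e · length(M^{(1)}[E]) ≥ length(M^{(m)}[E])` for all `m ≥ 0`, provided all `r_j ≥ 1`. -/
theorem stmt_16 {p : ℕ} [Fact p.Prime] {k : Type*} [Field k] [CharP k p] [PerfectField k]
    (E : Polynomial (WittVector p k)) (e : ℕ) (he : 1 ≤ e)
    (hE : E.Monic) (hdeg : E.natDegree = e)
    (hco : ∀ i < e, (p : WittVector p k) ∣ E.coeff i)
    (hconst : ∃ v : (WittVector p k)ˣ, E.coeff 0 = (p : WittVector p k) * v)
    (s : ℕ) (r : Fin s → ℕ) :
    let 𝔖 := PowerSeries (WittVector p k)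
    let len : ℕ → WithBot ℕ∞ := fun n =>
      moduleLength 𝔖 (Submodule.torsionBy 𝔖 (twModel p k s r n) (E : 𝔖))
    (∀ n : ℕ, len n = ((∑ j, min e (p ^ n * r j) : ℕ) : WithBot ℕ∞)) ∧
    (∀ n : ℕ, len n ≤ len (n + 1)) ∧
    ((∀ j, 1 ≤ r j) → ∀ m : ℕ, len m ≤ e • len 1) := by
  intro 𝔖 len
  have : PerfectRing k p := PerfectField.toPerfectRing p
  have hlen (n : ℕ) : len n = ((∑ j, min e (p ^ n * r j) : ℕ) : WithBot ℕ∞) :=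
    moduleLength_torsionBy_twModel
      (hdeg ▸ Polynomial.p_dvd_coe_sub_X_pow hE (by rwa [hdeg])) s r n
  have hp : 1 ≤ p := (Fact.out : p.Prime).one_le
  refine ⟨hlen, fun n ↦ ?_, fun hr m ↦ ?_⟩
  · rw [hlen, hlen]
    have : ∑ j, min e (p ^ n * r j) ≤ ∑ j, min e (p ^ (n + 1) * r j) := by
      gcongr
      exact n.le_succ
    exact_mod_cast this
  · rw [hlen, hlen, nsmul_eq_mul]
    have : ∑ j, min e (p ^ m * r j) ≤ e * ∑ j, min e (p ^ 1 * r j) := by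
      rw [Finset.mul_sum]
      refine Finset.sum_le_sum fun j _ ↦ (min_le_left _ _).trans (Nat.le_mul_of_pos_right e ?_)
      exact lt_min he (by have := hr j; positivity)
    exact_mod_cast this
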